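/- arXiv:2404.12710 — 4 statements merged into one kernel-verified Lean document; each statement's English description precedes it below -/
import Mathlib

section
/- Let E be a finite-dimensional real inner product space and f : E → ℝ a differentiable function whose gradient ∇f is L-Lipschitz for some L > 0, i.e. ‖∇f(x) − ∇f(y)‖ ≤ L‖x − y‖ for all x, y. Let (Ω, ℙ) be a probability space and X : Ω → E a Bochner-integrable random vector with 𝔼‖X‖² < ∞. Fix w ∈ E and reals μ > 0, M ≥ 0, M_G > 0, a > 0, η with 0 < η ≤ μ / (L·M_G·a). If 𝔼[⟪∇f(w), X⟫] ≥ μ‖∇f(w)‖² and 𝔼‖X‖² ≤ M + M_G‖∇f(w)‖², and ω ↦ f(w − η·a·X(ω)) is integrable, then 𝔼[f(w − η·a·X)] ≤ f(w) − (1/2)·η·a·μ·‖∇f(w)‖² + (1/2)·η²·a²·L·M. -/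
open MeasureTheory RealInnerProductSpace

/-- The descent lemma: a function with `L`-Lipschitz gradient is bounded above by its quadratic
model at any point. -/
theorem le_quadratic_of_lipschitz_gradient
    {E : Type*} [NormedAddCommGroup E] [InnerProductSpace ℝ E] [CompleteSpace E]
    {f : E → ℝ} (hf : Differentiable ℝ f) {L : ℝ}
    (hlip : ∀ x y : E, ‖gradient f x - gradient f y‖ ≤ L * ‖x - y‖) (x v : E) :
    f (x + v) ≤ f x + ⟪gradient f x, v⟫ + L / 2 * ‖v‖ ^ 2 := by
  set φ : ℝ → ℝ := fun t => f (x + t • v) - t * ⟪gradient f x, v⟫ - t ^ 2 * (L / 2 * ‖v‖ ^ 2)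
    with hφ
  have hderiv (t : ℝ) : HasDerivAt φ
      (⟪gradient f (x + t • v), v⟫ - ⟪gradient f x, v⟫ - 2 * t * (L / 2 * ‖v‖ ^ 2)) t := by
    have hline : HasDerivAt (fun s : ℝ => x + s • v) v t := by
      simpa using ((hasDerivAt_id t).smul_const v).const_add x
    have hcomp := (hf (x + t • v)).hasGradientAt.hasFDerivAt.comp_hasDerivAt t hline
    have hlin := (hasDerivAt_id t).mul_const ⟪gradient f x, v⟫
    have hsq := (hasDerivAt_pow 2 t).mul_const (L / 2 * ‖v‖ ^ 2)
    refine ((hcomp.sub hlin).sub hsq).congr_deriv ?_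
    simp
  have hanti : AntitoneOn φ (Set.Ici 0) := by
    refine antitoneOn_of_deriv_nonpos (convex_Ici 0)
      (fun t _ => (hderiv t).continuousAt.continuousWithinAt)
      (fun t _ => (hderiv t).differentiableAt.differentiableWithinAt) fun t ht => ?_
    have ht0 : 0 < t := by simpa using ht
    have hgrad : ‖gradient f (x + t • v) - gradient f x‖ ≤ L * (t * ‖v‖) := by
      simpa [norm_smul, abs_of_pos ht0] using hlip (x + t • v) x
    rw [(hderiv t).deriv, ← inner_sub_left]
    have hcs := real_inner_le_norm (gradient f (x + t • v) - gradient f x) v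
    have hmul := mul_le_mul_of_nonneg_right hgrad (norm_nonneg v)
    nlinarith
  have h := hanti (Set.mem_Ici.2 le_rfl) (Set.mem_Ici.2 zero_le_one) zero_le_one
  simp only [hφ, one_smul, zero_smul, add_zero] at h
  linarith

/-- One-step expected descent inequality for a stochastic update `w ↦ w − η a X` along a
stochastic gradient `X` under an `L`-Lipschitz-gradient assumption. -/
theorem expected_descent_step
    {E : Type*} [NormedAddCommGroup E] [InnerProductSpace ℝ E] [FiniteDimensional ℝ E]
    (f : E → ℝ) (hf : Differentiable ℝ f) (L : ℝ) (hL : 0 < L)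
    (hlip : ∀ x y : E, ‖gradient f x - gradient f y‖ ≤ L * ‖x - y‖)
    {Ω : Type*} [MeasurableSpace Ω] (P : Measure Ω) [IsProbabilityMeasure P]
    (X : Ω → E) (hX : Integrable X P) (hX2 : Integrable (fun ω => ‖X ω‖ ^ 2) P)
    (w : E) (μ M M_G a η : ℝ)
    (hμ : 0 < μ) (hM : 0 ≤ M) (hMG : 0 < M_G) (ha : 0 < a)
    (hη : 0 < η) (hηle : η ≤ μ / (L * M_G * a))
    (hinner : (∫ ω, ⟪gradient f w, X ω⟫ ∂P) ≥ μ * ‖gradient f w‖ ^ 2)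
    (hsecond : (∫ ω, ‖X ω‖ ^ 2 ∂P) ≤ M + M_G * ‖gradient f w‖ ^ 2)
    (hint : Integrable (fun ω => f (w - (η * a) • X ω)) P) :
    (∫ ω, f (w - (η * a) • X ω) ∂P) ≤
      f w - (1 / 2) * η * a * μ * ‖gradient f w‖ ^ 2 + (1 / 2) * η ^ 2 * a ^ 2 * L * M := by
  have hpoint (ω : Ω) : f (w - (η * a) • X ω) ≤
      f w - η * a * ⟪gradient f w, X ω⟫ + L / 2 * (η * a) ^ 2 * ‖X ω‖ ^ 2 := by
    have h := le_quadratic_of_lipschitz_gradient hf hlip w (-((η * a) • X ω))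
    rw [← sub_eq_add_neg, inner_neg_right, real_inner_smul_right, norm_neg, norm_smul,
      mul_pow, Real.norm_eq_abs, sq_abs] at h
    linarith
  have hin : Integrable (fun ω => η * a * ⟪gradient f w, X ω⟫) P :=
    (hX.const_inner (gradient f w)).const_mul (η * a)
  have hsq : Integrable (fun ω => L / 2 * (η * a) ^ 2 * ‖X ω‖ ^ 2) P := hX2.const_mul _
  have hlow : Integrable (fun ω => f w - η * a * ⟪gradient f w, X ω⟫) P :=
    (integrable_const (f w)).sub hin
  have hmono := integral_mono hint (hlow.add hsq) hpoint
  rw [integral_add' hlow hsq, integral_sub (integrable_const (f w)) hin, integral_const_mul,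
    integral_const_mul] at hmono
  simp only [integral_const, probReal_univ, one_smul] at hmono
  have hstep : η * (L * M_G * a) ≤ μ := (le_div_iff₀ (by positivity)).1 hηle
  have hfirst := mul_le_mul_of_nonneg_left hinner (by positivity : 0 ≤ η * a)
  have hquad := mul_le_mul_of_nonneg_left hsecond (by positivity : 0 ≤ L / 2 * (η * a) ^ 2)
  have habsorb := mul_le_mul_of_nonneg_left hstep
    (by positivity : 0 ≤ η * a / 2 * ‖gradient f w‖ ^ 2)
  linarith
end

section
/- Let E be a finite-dimensional real inner product space, c > 0, L > 0, and f : E → ℝ a differentiable function that is c-strongly convex (i.e. x ↦ f(x) − (c/2)‖x‖² is convex) and whose gradient ∇f is L-Lipschitz. Suppose f attains its minimum value f* at w* ∈ E. Let (Ω, ℙ) be a probability space and X : Ω → E a Bochner-integrable random vector with 𝔼‖X‖² < ∞. Fix w ∈ E and reals μ > 0, M ≥ 0, M_G > 0, a > 0, η with 0 < η ≤ μ / (L·M_G·a). If 𝔼[⟪∇f(w), X⟫] ≥ μ‖∇f(w)‖², 𝔼‖X‖² ≤ M + M_G‖∇f(w)‖², and ω ↦ f(w − η·a·X(ω)) is integrable,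 then 𝔼[f(w − η·a·X)] − f* ≤ (1 − η·a·c·μ)·(f(w) − f*) + (1/2)·η²·a²·L·M. -/
open MeasureTheory RealInnerProductSpace

section GradientInequalities

variable {E : Type*} [NormedAddCommGroup E] [InnerProductSpace ℝ E] [CompleteSpace E] {f : E → ℝ}

lemma DifferentiableAt.hasDerivAt_comp_add_smul {x v : E} {t : ℝ}
    (hf : DifferentiableAt ℝ f (x + t • v)) :
    HasDerivAt (fun s : ℝ => f (x + s • v)) ⟪gradient f (x + t • v), v⟫ t := by
  have hline : HasDerivAt (fun s : ℝ => x + s • v) v t := by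
    simpa using ((hasDerivAt_id t).smul_const v).const_add x
  exact hf.hasGradientAt.hasFDerivAt.comp_hasDerivAt t hline

/-- The descent lemma: a function with `L`-Lipschitz gradient lies below its quadratic model. -/
lemma le_add_inner_gradient_add_sq_of_lipschitz {L : ℝ} (hf : Differentiable ℝ f)
    (hlip : ∀ x y : E, ‖gradient f x - gradient f y‖ ≤ L * ‖x - y‖) (x v : E) :
    f (x + v) ≤ f x + ⟪gradient f x, v⟫ + L / 2 * ‖v‖ ^ 2 := by
  let φ : ℝ → ℝ := fun t => f (x + t • v) - t * ⟪gradient f x, v⟫ - t ^ 2 * (L / 2 * ‖v‖ ^ 2)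
  have hφ (t : ℝ) : HasDerivAt φ (⟪gradient f (x + t • v), v⟫ - ⟪gradient f x, v⟫
      - 2 * t * (L / 2 * ‖v‖ ^ 2)) t := by
    have hline := (hf (x + t • v)).hasDerivAt_comp_add_smul
    have hlin := (hasDerivAt_id t).mul_const ⟪gradient f x, v⟫
    have hsq := (hasDerivAt_pow 2 t).mul_const (L / 2 * ‖v‖ ^ 2)
    exact ((hline.fun_sub hlin).fun_sub hsq).congr_deriv (by norm_num)
  have hanti : AntitoneOn φ (Set.Icc 0 1) := by
    refine antitoneOn_of_deriv_nonpos (convex_Icc 0 1)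
      (fun t _ => (hφ t).continuousAt.continuousWithinAt)
      (fun t _ => (hφ t).differentiableAt.differentiableWithinAt) fun t ht => ?_
    rw [interior_Icc] at ht
    rw [(hφ t).deriv, ← inner_sub_left]
    have hgrad : ‖gradient f (x + t • v) - gradient f x‖ ≤ L * (t * ‖v‖) := by
      simpa [norm_smul, abs_of_pos ht.1] using hlip (x + t • v) x
    have hbound := (real_inner_le_norm (gradient f (x + t • v) - gradient f x) v).trans
      (mul_le_mul_of_nonneg_right hgrad (norm_nonneg v))
    linarith
  have hle := hanti (Set.left_mem_Icc.2 zero_le_one) (Set.right_mem_Icc.2 zero_le_one) zero_le_one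
  simp only [φ, one_smul, zero_smul, add_zero] at hle
  linarith

/-- A strongly convex function lies above its quadratic model. -/
lemma StrongConvexOn.add_inner_gradient_add_sq_le {c : ℝ} (hconv : StrongConvexOn Set.univ c f)
    {x : E} (hf : DifferentiableAt ℝ f x) (v : E) :
    f x + ⟪gradient f x, v⟫ + c / 2 * ‖v‖ ^ 2 ≤ f (x + v) := by
  let φ : ℝ → ℝ := fun t => f (x + t • v) - c / 2 * ‖x + t • v‖ ^ 2
  have hφconv : ConvexOn ℝ Set.univ φ := by
    have h := (strongConvexOn_iff_convex.1 hconv).comp_affineMap (AffineMap.lineMap x (x + v))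
    simpa [φ, Function.comp_def, AffineMap.lineMap_apply, add_comm] using h
  have hφ : HasDerivAt φ (⟪gradient f x, v⟫ - c / 2 * (2 * ⟪x, v⟫)) 0 := by
    have hline : HasDerivAt (fun s : ℝ => x + s • v) v 0 := by
      simpa using ((hasDerivAt_id (0 : ℝ)).smul_const v).const_add x
    have hcomp : HasDerivAt (fun s : ℝ => f (x + s • v)) ⟪gradient f x, v⟫ 0 := by
      simpa using DifferentiableAt.hasDerivAt_comp_add_smul (f := f) (x := x) (v := v) (t := 0)
        (by simpa using hf)
    exact (hcomp.fun_sub (hline.norm_sq.const_mul (c / 2))).congr_deriv (by simp)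
  have hslope := hφconv.le_slope_of_hasDerivAt (Set.mem_univ 0) (Set.mem_univ 1) zero_lt_one hφ
  simp only [slope_def_field, φ, one_smul, zero_smul, add_zero, sub_zero, div_one,
    norm_add_sq_real x v] at hslope
  linarith

/-- The Polyak–Łojasiewicz inequality for strongly convex functions. -/
lemma StrongConvexOn.two_mul_sub_le_norm_gradient_sq {c : ℝ} (hc : 0 < c)
    (hconv : StrongConvexOn Set.univ c f) {x : E} (hf : DifferentiableAt ℝ f x) (y : E) :
    2 * c * (f x - f y) ≤ ‖gradient f x‖ ^ 2 := by
  have hlower := hconv.add_inner_gradient_add_sq_le hf (y - x)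
  rw [add_sub_cancel] at hlower
  have hsq := norm_add_sq_real (gradient f x) (c • (y - x))
  rw [inner_smul_right, norm_smul, mul_pow, Real.norm_eq_abs, sq_abs] at hsq
  nlinarith [sq_nonneg ‖gradient f x + c • (y - x)‖, mul_le_mul_of_nonneg_left hlower hc.le]

end GradientInequalities

/-- Per-iteration contraction inequality: one stochastic gradient-correction step contracts
the expected optimality gap with factor `1 − η a c μ` up to an additive `(1/2)η²a²LM`. -/
theorem expected_contraction_step
    {E : Type*} [NormedAddCommGroup E] [InnerProductSpace ℝ E] [FiniteDimensional ℝ E]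
    (c L : ℝ) (hc : 0 < c) (hL : 0 < L)
    (f : E → ℝ) (hf : Differentiable ℝ f)
    (hconv : ConvexOn ℝ Set.univ fun x => f x - (c / 2) * ‖x‖ ^ 2)
    (hlip : ∀ x y : E, ‖gradient f x - gradient f y‖ ≤ L * ‖x - y‖)
    (wStar : E) (hmin : ∀ x : E, f wStar ≤ f x)
    {Ω : Type*} [MeasurableSpace Ω] (P : Measure Ω) [IsProbabilityMeasure P]
    (X : Ω → E) (hX : Integrable X P) (hX2 : Integrable (fun ω => ‖X ω‖ ^ 2) P)
    (w : E) (μ M M_G a η : ℝ)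
    (hμ : 0 < μ) (hM : 0 ≤ M) (hMG : 0 < M_G) (ha : 0 < a)
    (hη : 0 < η) (hηle : η ≤ μ / (L * M_G * a))
    (hinner : (∫ ω, ⟪gradient f w, X ω⟫ ∂P) ≥ μ * ‖gradient f w‖ ^ 2)
    (hsecond : (∫ ω, ‖X ω‖ ^ 2 ∂P) ≤ M + M_G * ‖gradient f w‖ ^ 2)
    (hint : Integrable (fun ω => f (w - (η * a) • X ω)) P) :
    (∫ ω, f (w - (η * a) • X ω) ∂P) - f wStar ≤
      (1 - η * a * c * μ) * (f w - f wStar) + (1 / 2) * η ^ 2 * a ^ 2 * L * M := by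
  have hpl := (strongConvexOn_iff_convex.2 hconv).two_mul_sub_le_norm_gradient_sq hc (hf w) wStar
  have hinnerInt : Integrable (fun ω => ⟪gradient f w, X ω⟫) P := hX.const_inner _
  have hdescent : (∫ ω, f (w - (η * a) • X ω) ∂P) ≤
      f w - η * a * (∫ ω, ⟪gradient f w, X ω⟫ ∂P)
        + L / 2 * (η * a) ^ 2 * ∫ ω, ‖X ω‖ ^ 2 ∂P := by
    have hlinInt : Integrable (fun ω => f w - η * a * ⟪gradient f w, X ω⟫) P :=
      (integrable_const _).sub (hinnerInt.const_mul _)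
    have hsqInt := hX2.const_mul (L / 2 * (η * a) ^ 2)
    calc (∫ ω, f (w - (η * a) • X ω) ∂P)
        ≤ ∫ ω, (f w - η * a * ⟪gradient f w, X ω⟫) + L / 2 * (η * a) ^ 2 * ‖X ω‖ ^ 2 ∂P := by
          refine integral_mono hint (hlinInt.add hsqInt) fun ω => ?_
          have h := le_add_inner_gradient_add_sq_of_lipschitz hf hlip w (-((η * a) • X ω))
          rw [← sub_eq_add_neg, inner_neg_right, inner_smul_right, norm_neg, norm_smul, mul_pow,
            Real.norm_eq_abs, sq_abs] at h
          dsimp only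
          linarith
      _ = _ := by
          rw [integral_add hlinInt hsqInt,
            integral_sub (integrable_const _) (hinnerInt.const_mul _), integral_const_mul,
            integral_const_mul]
          simp
  have hstep : η * a * (L * M_G) ≤ μ := by
    rw [le_div_iff₀ (by positivity)] at hηle
    linarith
  have hinner' := mul_le_mul_of_nonneg_left hinner.le (by positivity : 0 ≤ η * a)
  have hsecond' := mul_le_mul_of_nonneg_left hsecond (by positivity : 0 ≤ L / 2 * (η * a) ^ 2)
  have hstep' := mul_le_mul_of_nonneg_left hstep
    (by positivity : 0 ≤ η * a / 2 * ‖gradient f w‖ ^ 2)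
  have hpl' := mul_le_mul_of_nonneg_left hpl (by positivity : 0 ≤ η * a * μ / 2)
  linarith
end

section
/- Let E be a finite-dimensional real inner product space, c > 0, L > 0 with c ≤ L, and f : E → ℝ a differentiable function that is c-strongly convex (i.e. x ↦ f(x) − (c/2)‖x‖² is convex) and whose gradient ∇f is L-Lipschitz. Suppose f attains its minimum value f* at w* ∈ E. Let μ > 0, M ≥ 0, M_G ≥ μ² be reals, and let (w_s)_{s≥1} in E, (g_s)_{s≥1} in E, (a_s)_{s≥1} and (η_s)_{s≥1} in ℝ satisfy, for every s ≥ 1: a_s > 0, 0 < η_s ≤ μ / (L·M_G·a_s), ⟪∇f(w_s), g_s⟫ ≥ μ‖∇f(w_s)‖², ‖g_s‖² ≤ M + M_G‖∇f(w_s)‖², and w_{s+1} = w_s − η_s·a_s·g_s. Then for every s ≥ 1, f(w_{s+1}) − f* ≤ (∏_{i=1}^{s} (1 − η_i·a_i·c·μ))·(f(w_1) − f*) + L·M / (2·c²·μ²). -/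
open RealInnerProductSpace

section SmoothStronglyConvex

variable {E : Type*} [NormedAddCommGroup E] [InnerProductSpace ℝ E]

/-- The derivative of a differentiable function along a line is given by its gradient. -/
theorem hasDerivAt_comp_line_of_differentiable [CompleteSpace E] {f : E → ℝ}
    (hf : Differentiable ℝ f) (x v : E) (t : ℝ) :
    HasDerivAt (fun t : ℝ => f (x + t • v)) ⟪gradient f (x + t • v), v⟫ t := by
  have hline : HasDerivAt (fun t : ℝ => x + t • v) v t := by
    simpa using ((hasDerivAt_id t).smul_const v).const_add x
  rw [← InnerProductSpace.toDual_apply_apply (𝕜 := ℝ)]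
  exact (hf (x + t • v)).hasGradientAt.hasFDerivAt.comp_hasDerivAt t hline

/-- The quadratic upper bound for a function with Lipschitz gradient. -/
theorem le_add_inner_gradient_add_of_lipschitz_gradient [CompleteSpace E] {f : E → ℝ}
    (hf : Differentiable ℝ f) {L : ℝ}
    (hlip : ∀ x y : E, ‖gradient f x - gradient f y‖ ≤ L * ‖x - y‖) (x v : E) :
    f (x + v) ≤ f x + ⟪gradient f x, v⟫ + L / 2 * ‖v‖ ^ 2 := by
  have hderiv (t : ℝ) : HasDerivAt
      (fun t : ℝ => f (x + t • v) - (t * ⟪gradient f x, v⟫ + t ^ 2 * (L / 2 * ‖v‖ ^ 2)))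
      (⟪gradient f (x + t • v), v⟫ - (⟪gradient f x, v⟫ + t * (L * ‖v‖ ^ 2))) t := by
    refine ((hasDerivAt_comp_line_of_differentiable hf x v t).sub
      (((hasDerivAt_id t).mul_const ⟪gradient f x, v⟫).add
        (((hasDerivAt_id t).pow 2).mul_const (L / 2 * ‖v‖ ^ 2)))).congr_deriv ?_
    simp
    ring
  have hanti : AntitoneOn
      (fun t : ℝ => f (x + t • v) - (t * ⟪gradient f x, v⟫ + t ^ 2 * (L / 2 * ‖v‖ ^ 2)))
      (Set.Ici 0) := by
    refine antitoneOn_of_deriv_nonpos (convex_Ici 0)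
      (fun t _ => (hderiv t).continuousAt.continuousWithinAt)
      (fun t _ => (hderiv t).differentiableAt.differentiableWithinAt) fun t ht => ?_
    rw [interior_Ici, Set.mem_Ioi] at ht
    rw [(hderiv t).deriv, ← sub_sub, ← inner_sub_left, sub_nonpos]
    calc ⟪gradient f (x + t • v) - gradient f x, v⟫
        ≤ ‖gradient f (x + t • v) - gradient f x‖ * ‖v‖ := real_inner_le_norm _ _
      _ ≤ L * ‖x + t • v - x‖ * ‖v‖ := by gcongr; exact hlip _ _
      _ = t * (L * ‖v‖ ^ 2) := by
        rw [add_sub_cancel_left, norm_smul, Real.norm_of_nonneg ht.le]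
        ring
  have h := hanti (Set.mem_Ici.2 le_rfl) (Set.mem_Ici.2 zero_le_one) zero_le_one
  simp only [one_smul, zero_smul, add_zero] at h
  linarith

/-- The quadratic lower bound for a differentiable strongly convex function. -/
theorem add_inner_gradient_add_le_of_stronglyConvex [CompleteSpace E] {f : E → ℝ}
    (hf : Differentiable ℝ f) {c : ℝ}
    (hconv : ConvexOn ℝ Set.univ fun x => f x - (c / 2) * ‖x‖ ^ 2) (x v : E) :
    f x + ⟪gradient f x, v⟫ + c / 2 * ‖v‖ ^ 2 ≤ f (x + v) := by
  have hsq (t : ℝ) : ‖x + t • v‖ ^ 2 = ‖x‖ ^ 2 + t * (2 * ⟪x, v⟫) + t ^ 2 * ‖v‖ ^ 2 := by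
    rw [norm_add_sq_real, inner_smul_right, norm_smul, mul_pow, Real.norm_eq_abs, sq_abs]
    ring
  have hline : ConvexOn ℝ Set.univ fun t : ℝ => f (x + t • v) - c / 2 * ‖x + t • v‖ ^ 2 := by
    have h := hconv.comp_affineMap (AffineMap.lineMap x (x + v))
    simpa [Function.comp_def, AffineMap.lineMap_apply, add_comm] using h
  have hderiv : HasDerivAt (fun t : ℝ => f (x + t • v) - c / 2 * ‖x + t • v‖ ^ 2)
      (⟪gradient f x, v⟫ - c * ⟪x, v⟫) 0 := by
    simp only [hsq]
    refine ((hasDerivAt_comp_line_of_differentiable hf x v 0).sub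
      (((((hasDerivAt_id (0 : ℝ)).mul_const (2 * ⟪x, v⟫)).const_add (‖x‖ ^ 2)).add
        (((hasDerivAt_id (0 : ℝ)).pow 2).mul_const (‖v‖ ^ 2))).const_mul (c / 2))).congr_deriv ?_
    simp
    ring
  have h := hline.le_slope_of_hasDerivAt (Set.mem_univ 0) (Set.mem_univ 1) zero_lt_one hderiv
  have h1 := hsq 1
  simp only [slope_def_field, one_smul, zero_smul, add_zero, sub_zero, div_one] at h h1
  rw [h1] at h
  linarith

/-- The Polyak–Łojasiewicz inequality for a differentiable strongly convex function. -/
theorem two_mul_sub_le_norm_gradient_sq_of_stronglyConvex [CompleteSpace E] {f : E → ℝ}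
    (hf : Differentiable ℝ f) {c : ℝ} (hc : 0 < c)
    (hconv : ConvexOn ℝ Set.univ fun x => f x - (c / 2) * ‖x‖ ^ 2) (x y : E) :
    2 * c * (f x - f y) ≤ ‖gradient f x‖ ^ 2 := by
  have h := add_inner_gradient_add_le_of_stronglyConvex hf hconv x (y - x)
  rw [add_sub_cancel] at h
  have hinner := neg_le_of_abs_le (abs_real_inner_le_norm (gradient f x) (y - x))
  nlinarith [sq_nonneg (‖gradient f x‖ - c * ‖y - x‖)]

/-- One gradient-correction step with direction `g` and step size `α` contracts the optimality
gap, up to a noise term quadratic in `α`. -/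
theorem sub_le_of_gradient_correction_step [CompleteSpace E] {f : E → ℝ}
    (hf : Differentiable ℝ f) {c L : ℝ} (hc : 0 < c) (hL : 0 < L)
    (hconv : ConvexOn ℝ Set.univ fun x => f x - (c / 2) * ‖x‖ ^ 2)
    (hlip : ∀ x y : E, ‖gradient f x - gradient f y‖ ≤ L * ‖x - y‖)
    {μ M M_G α : ℝ} (hμ : 0 < μ) (hα : 0 < α) (hαμ : α * (L * M_G) ≤ μ) {x g : E}
    (hinner : μ * ‖gradient f x‖ ^ 2 ≤ ⟪gradient f x, g⟫)
    (hg : ‖g‖ ^ 2 ≤ M + M_G * ‖gradient f x‖ ^ 2) (y : E) :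
    f (x - α • g) - f y ≤ (1 - α * c * μ) * (f x - f y) + L * α ^ 2 * M / 2 := by
  have hdescent := le_add_inner_gradient_add_of_lipschitz_gradient hf hlip x (-(α • g))
  rw [← sub_eq_add_neg, inner_neg_right, inner_smul_right, norm_neg, norm_smul, mul_pow,
    Real.norm_of_nonneg hα.le] at hdescent
  have hpl := two_mul_sub_le_norm_gradient_sq_of_stronglyConvex hf hc hconv x y
  have h1 := mul_le_mul_of_nonneg_left hinner hα.le
  have h2 := mul_le_mul_of_nonneg_left hg (by positivity : 0 ≤ L / 2 * α ^ 2)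
  have h3 := mul_le_mul_of_nonneg_left hαμ
    (by positivity : 0 ≤ α / 2 * ‖gradient f x‖ ^ 2)
  have h4 := mul_le_mul_of_nonneg_left hpl (by positivity : 0 ≤ α * μ / 2)
  linarith

end SmoothStronglyConvex

/-- A perturbed contraction whose perturbations are absorbed by a fixed residual `R`. -/
theorem le_prod_mul_add_of_perturbed_contraction {u q b : ℕ → ℝ} {R : ℝ} (hR : 0 ≤ R)
    (hq : ∀ s ≥ 1, 0 ≤ q s) (hb : ∀ s ≥ 1, q s * R + b s ≤ R)
    (hu : ∀ s ≥ 1, u (s + 1) ≤ q s * u s + b s) (s : ℕ) :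
    u (s + 1) ≤ (∏ i ∈ Finset.Icc 1 s, q i) * u 1 + R := by
  induction s with
  | zero => simpa using hR
  | succ n ih =>
    have hn : n + 1 ≥ 1 := n.succ_pos
    rw [Finset.prod_Icc_succ_top hn]
    have h := mul_le_mul_of_nonneg_left ih (hq _ hn)
    linarith [hu _ hn, hb _ hn]

/-- Deterministic core of FedMeS Theorem 1: the gradient-correction recursion drives the
optimality gap down to `LM/(2c²μ²)` up to a product of contraction factors. -/
theorem fedmes_theorem1_recursion
    {E : Type*} [NormedAddCommGroup E] [InnerProductSpace ℝ E] [FiniteDimensional ℝ E]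
    (c L : ℝ) (hc : 0 < c) (hL : 0 < L) (hcL : c ≤ L)
    (f : E → ℝ) (hf : Differentiable ℝ f)
    (hconv : ConvexOn ℝ Set.univ fun x => f x - (c / 2) * ‖x‖ ^ 2)
    (hlip : ∀ x y : E, ‖gradient f x - gradient f y‖ ≤ L * ‖x - y‖)
    (wStar : E) (hmin : ∀ x : E, f wStar ≤ f x)
    (μ M M_G : ℝ) (hμ : 0 < μ) (hM : 0 ≤ M) (hMG : μ ^ 2 ≤ M_G)
    (w g : ℕ → E) (a η : ℕ → ℝ)
    (ha : ∀ s ≥ 1, 0 < a s)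
    (hη : ∀ s ≥ 1, 0 < η s ∧ η s ≤ μ / (L * M_G * a s))
    (hinner : ∀ s ≥ 1, ⟪gradient f (w s), g s⟫ ≥ μ * ‖gradient f (w s)‖ ^ 2)
    (hgbound : ∀ s ≥ 1, ‖g s‖ ^ 2 ≤ M + M_G * ‖gradient f (w s)‖ ^ 2)
    (hupd : ∀ s ≥ 1, w (s + 1) = w s - (η s * a s) • g s) :
    ∀ s ≥ 1, f (w (s + 1)) - f wStar ≤
      (∏ i ∈ Finset.Icc 1 s, (1 - η i * a i * c * μ)) * (f (w 1) - f wStar) +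
        L * M / (2 * c ^ 2 * μ ^ 2) := by
  have hMG0 : 0 < M_G := lt_of_lt_of_le (by positivity) hMG
  have hα (s : ℕ) (hs : s ≥ 1) : 0 < η s * a s := mul_pos (hη s hs).1 (ha s hs)
  have hαμ (s : ℕ) (hs : s ≥ 1) : η s * a s * (L * M_G) ≤ μ := by
    have has := ha s hs
    have h := (le_div_iff₀ (by positivity)).1 (hη s hs).2
    linarith
  have hαc (s : ℕ) (hs : s ≥ 1) : η s * a s * c * μ ≤ 1 := by
    have hαs := hα s hs
    have hprod : c * μ ^ 2 ≤ L * M_G := by gcongr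
    refine le_of_mul_le_mul_right ?_ hμ
    linarith [hαμ s hs, mul_le_mul_of_nonneg_left hprod hαs.le]
  intro s _
  refine le_prod_mul_add_of_perturbed_contraction (u := fun s => f (w s) - f wStar)
    (b := fun s => L * (η s * a s) ^ 2 * M / 2) (by positivity)
    (fun s hs => sub_nonneg.2 (hαc s hs)) (fun s hs => ?_) (fun s hs => ?_) s
  · have hαs := hα s hs
    have h := mul_le_mul_of_nonneg_left (hαc s hs)
      (by positivity : 0 ≤ L * M * (η s * a s) / (2 * c * μ))
    have h1 : L * M * (η s * a s) / (2 * c * μ) * (η s * a s * c * μ) =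
        L * (η s * a s) ^ 2 * M / 2 := by
      field_simp
    have h2 : (1 - η s * a s * c * μ) * (L * M / (2 * c ^ 2 * μ ^ 2)) =
        L * M / (2 * c ^ 2 * μ ^ 2) - L * M * (η s * a s) / (2 * c * μ) := by
      field_simp
    linarith
  · rw [hupd s hs]
    exact sub_le_of_gradient_correction_step hf hc hL hconv hlip hμ (hα s hs) (hαμ s hs)
      (hinner s hs) (hgbound s hs) wStar
end

section
/- Let E be a real inner product space, c > 0, λ ≥ 0, and L : E → ℝ a differentiable function that is c-strongly convex, i.e. x ↦ L(x) − (c/2)‖x‖² is convex. Let v₁, v₂ ∈ E, and suppose w₁ minimizes w ↦ L(w) + (λ/2)‖w − v₁‖² over E and w₂ minimizes w ↦ L(w) + (λ/2)‖w − v₂‖² over E. Then ‖w₁ − w₂‖ ≤ (λ/(c + λ))·‖v₁ − v₂‖. -/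
/-- A strongly convex function grows at least quadratically away from a minimizer. -/
theorem StrongConvexOn.add_sq_norm_sub_le_of_isMinOn
    {E : Type*} [NormedAddCommGroup E] [NormedSpace ℝ E] {s : Set E} {m : ℝ} {f : E → ℝ}
    (hf : StrongConvexOn s m f) {x y : E} (hx : x ∈ s) (hy : y ∈ s) (hmin : IsMinOn f s x) :
    f x + m / 2 * ‖x - y‖ ^ 2 ≤ f y := by
  have key : ∀ t ∈ Set.Ioo (0 : ℝ) 1, f x + (1 - t) * (m / 2 * ‖x - y‖ ^ 2) ≤ f y := by
    rintro t ⟨ht0, ht1⟩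
    have h1t : 0 ≤ 1 - t := by linarith
    have hconv := hf.2 hx hy h1t ht0.le (by ring)
    have hle := isMinOn_iff.mp hmin _ (hf.1 hx hy h1t ht0.le (by ring))
    simp only [smul_eq_mul] at hconv
    refine le_of_mul_le_mul_left ?_ ht0
    linarith
  have hcont : Continuous fun t : ℝ => f x + (1 - t) * (m / 2 * ‖x - y‖ ^ 2) := by fun_prop
  have hlim := (hcont.tendsto 0).mono_left (nhdsWithin_le_nhds (s := Set.Ioi 0))
  simp only [sub_zero, one_mul] at hlim
  exact le_of_tendsto hlim
    (Filter.eventually_of_mem (Ioo_mem_nhdsGT one_pos) key)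

/-- Adding `(l / 2) * ‖x - v‖ ^ 2` raises the modulus of strong convexity by `l`. -/
theorem StrongConvexOn.add_sq_norm_sub
    {E : Type*} [NormedAddCommGroup E] [InnerProductSpace ℝ E] {s : Set E} {m : ℝ} {f : E → ℝ}
    (hf : StrongConvexOn s m f) (l : ℝ) (v : E) :
    StrongConvexOn s (m + l) fun x => f x + l / 2 * ‖x - v‖ ^ 2 := by
  rw [strongConvexOn_iff_convex] at hf ⊢
  have hlin : ConvexOn ℝ s (innerₛₗ ℝ (-l • v)) := LinearMap.convexOn _ hf.1
  refine ((hf.add hlin).add_const (l / 2 * ‖v‖ ^ 2)).congr fun x _ => ?_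
  simp only [Pi.add_apply, innerₛₗ_apply_apply, norm_sub_sq_real, real_inner_smul_left,
    real_inner_comm x v]
  ring

/-- Lipschitz dependence of the personalized minimizer on the global model:
if `wᵢ` minimizes `w ↦ L(w) + (λ/2)‖w − vᵢ‖²` for a `c`-strongly convex `L`, then
`‖w₁ − w₂‖ ≤ (λ/(c+λ))‖v₁ − v₂‖`. -/
theorem personalized_minimizer_lipschitz
    {E : Type*} [NormedAddCommGroup E] [InnerProductSpace ℝ E]
    (c lam : ℝ) (hc : 0 < c) (hlam : 0 ≤ lam)
    (L : E → ℝ) (hL : Differentiable ℝ L)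
    (hconv : ConvexOn ℝ Set.univ fun x => L x - (c / 2) * ‖x‖ ^ 2)
    (v₁ v₂ w₁ w₂ : E)
    (hw₁ : ∀ w : E, L w₁ + (lam / 2) * ‖w₁ - v₁‖ ^ 2 ≤ L w + (lam / 2) * ‖w - v₁‖ ^ 2)
    (hw₂ : ∀ w : E, L w₂ + (lam / 2) * ‖w₂ - v₂‖ ^ 2 ≤ L w + (lam / 2) * ‖w - v₂‖ ^ 2) :
    ‖w₁ - w₂‖ ≤ (lam / (c + lam)) * ‖v₁ - v₂‖ := by
  have hL' := strongConvexOn_iff_convex.mpr hconv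
  have h₁ := (hL'.add_sq_norm_sub lam v₁).add_sq_norm_sub_le_of_isMinOn
    (Set.mem_univ w₁) (Set.mem_univ w₂) (isMinOn_univ_iff.mpr hw₁)
  have h₂ := (hL'.add_sq_norm_sub lam v₂).add_sq_norm_sub_le_of_isMinOn
    (Set.mem_univ w₂) (Set.mem_univ w₁) (isMinOn_univ_iff.mpr hw₂)
  rw [norm_sub_rev w₂ w₁] at h₂
  have hinner : (c + lam) * ‖w₁ - w₂‖ ^ 2 ≤ lam * inner ℝ (w₁ - w₂) (v₁ - v₂) := by
    simp only [norm_sub_sq_real _ v₁, norm_sub_sq_real _ v₂] at h₁ h₂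
    simp only [inner_sub_left, inner_sub_right]
    linarith
  have hcs := mul_le_mul_of_nonneg_left (real_inner_le_norm (w₁ - w₂) (v₁ - v₂)) hlam
  have hpos : 0 < c + lam := by linarith
  rw [div_mul_eq_mul_div, le_div_iff₀ hpos]
  rcases (norm_nonneg (w₁ - w₂)).eq_or_lt with h0 | h0
  · rw [← h0, zero_mul]
    positivity
  · refine le_of_mul_le_mul_left ?_ h0
    linarith
end
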